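/- Fix a real number ε with 0 < ε < 1/8 and a finite alphabet A with at least two letters. For the uniform distribution on deterministic complete n-state automata over A, the probability that the automaton admits no synchronizing word of length smaller than n^{1+ε} is O(n^{−1/8+ε}) as n → ∞; in particular, with high probability a uniform random n-state automaton admits a synchronizing word of length smaller than n^{1+ε}. -/

import Mathlib

open Classical

/-- The action of a word on the states of a deterministic complete automaton:
`act δ w q` is the state reached from `q` after reading the word `w`
(first letter applied first, so that `δ_{wa} = δ_a ∘ δ_w`). -/
def act {n : ℕ} {A : Type*} (δ : Fin n → A → Fin n) : List A → Fin n → Fin n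
  | [], q => q
  | c :: w, q => act δ w (δ q c)

/-- A word `w` is synchronizing for `δ` if the induced action is a constant map. -/
def IsSyncWord {n : ℕ} {A : Type*} (δ : Fin n → A → Fin n) (w : List A) : Prop :=
  ∃ r : Fin n, ∀ q : Fin n, act δ w q = r

open Finset in
/-- The probability of `P` under the uniform distribution on `Ω`. -/
noncomputable def pr {Ω : Type*} [Fintype Ω] (P : Ω → Prop) : ℝ :=
  (#{ω | P ω} : ℝ) / Fintype.card Ω

section Probability

open Finset

variable {Ω Ω' : Type*} [Fintype Ω] [Fintype Ω']

lemma card_filter_div_card (P : Ω → Prop) [DecidablePred P] :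
    (#{ω | P ω} : ℝ) / Fintype.card Ω = pr P := by
  unfold pr
  congr!

lemma pr_nonneg (P : Ω → Prop) : 0 ≤ pr P := by
  unfold pr; positivity

lemma pr_le_one (P : Ω → Prop) : pr P ≤ 1 := by
  unfold pr
  refine div_le_one_of_le₀ ?_ (by positivity)
  exact_mod_cast card_le_univ _

lemma pr_mem (s : Finset Ω) : pr (fun ω => ω ∈ s) = #s / Fintype.card Ω := by
  simp [pr]

lemma pr_mono {P Q : Ω → Prop} (h : ∀ ω, P ω → Q ω) : pr P ≤ pr Q := by
  unfold pr
  gcongr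
  exact h _

lemma pr_mul_card (P : Ω → Prop) : pr P * Fintype.card Ω = #{ω | P ω} := by
  rcases isEmpty_or_nonempty Ω with h | h
  · simp [pr]
  · exact div_mul_cancel₀ _ (by simp)

lemma pr_mul_card_le_of_injective {Φ : Ω → Ω'} (hΦ : Function.Injective Φ) {P : Ω → Prop}
    {Q : Ω' → Prop} (h : ∀ ω, P ω → Q (Φ ω)) :
    pr P * Fintype.card Ω ≤ pr Q * Fintype.card Ω' := by
  have h1 : #{ω | P ω} ≤ #{ω | Q ω} :=
    card_le_card_of_injOn Φ (fun ω hω => by simpa using h ω (by simpa using hω)) hΦ.injOn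
  rw [pr_mul_card, pr_mul_card]
  exact_mod_cast h1

lemma pr_or_le (P Q : Ω → Prop) : pr (fun ω => P ω ∨ Q ω) ≤ pr P + pr Q := by
  unfold pr
  rw [← add_div]
  gcongr
  have h : (#{ω | P ω ∨ Q ω} : ℝ) ≤ #{ω | P ω} + #{ω | Q ω} := by
    rw [filter_or]
    exact_mod_cast card_union_le _ _
  refine le_of_eq_of_le ?_ h
  congr!

lemma pr_exists_le {ι : Type*} (s : Finset ι) (P : ι → Ω → Prop) :
    pr (fun ω => ∃ i ∈ s, P i ω) ≤ ∑ i ∈ s, pr (P i) := by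
  induction s using Finset.induction_on with
  | empty => simp [pr]
  | insert i s hi ih =>
    rw [sum_insert hi]
    refine le_trans ?_ ((pr_or_le (P i) (fun ω => ∃ i ∈ s, P i ω)).trans (by gcongr))
    exact pr_mono (fun ω => by simp)

lemma pr_add_not (P : Ω → Prop) [Nonempty Ω] : pr P + pr (fun ω => ¬ P ω) = 1 := by
  unfold pr
  rw [← add_div, div_eq_one_iff_eq (by simp)]
  have h : (#{ω | P ω} : ℝ) + #{ω | ¬ P ω} = Fintype.card Ω := by
    exact_mod_cast card_filter_add_card_filter_not (s := univ) P
  convert h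

lemma pr_equiv (e : Ω ≃ Ω') (P : Ω' → Prop) : pr (fun ω => P (e ω)) = pr P := by
  unfold pr
  rw [Fintype.card_congr e]
  congr 2
  refine card_equiv e (by simp)

lemma pr_prod (P : Ω × Ω' → Prop) :
    pr P = (∑ ω, pr (fun ω' => P (ω, ω'))) / Fintype.card Ω := by
  unfold pr
  rw [← sum_div, div_div, Fintype.card_prod, mul_comm (Fintype.card Ω)]
  push_cast
  congr 1
  have : #{x : Ω × Ω' | P x} = ∑ ω, #{ω' | P (ω, ω')} := by
    simp only [card_filter]
    rw [Fintype.sum_prod_type]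
  exact_mod_cast this

lemma pr_prod' (P : Ω × Ω' → Prop) :
    pr P = (∑ ω', pr (fun ω => P (ω, ω'))) / Fintype.card Ω' := by
  rw [← pr_prod (fun x : Ω' × Ω => P (x.2, x.1)), ← pr_equiv (Equiv.prodComm Ω Ω')]
  rfl

lemma pr_fst [Nonempty Ω'] (P : Ω → Prop) : pr (fun x : Ω × Ω' => P x.1) = pr P := by
  rw [pr_prod']
  simp only
  rw [sum_const, card_univ, nsmul_eq_mul, mul_div_cancel_left₀]
  simp

lemma pr_prod_le {P : Ω × Ω' → Prop} {Q : Ω → Prop} {c : ℝ} (hc : 0 ≤ c)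
    (h : ∀ ω, Q ω ∨ pr (fun ω' => P (ω, ω')) ≤ c) : pr P ≤ pr Q + c := by
  rw [pr_prod]
  rcases isEmpty_or_nonempty Ω with hΩ | hΩ
  · simpa [pr] using hc
  have h1 : ∀ ω, pr (fun ω' => P (ω, ω')) ≤ (if Q ω then 1 else 0) + c := by
    intro ω
    split_ifs with hQ
    · linarith [pr_le_one (fun ω' => P (ω, ω'))]
    · simpa using (h ω).resolve_left hQ
  rw [div_le_iff₀ (by simp [Fintype.card_pos])]
  refine (sum_le_sum fun ω _ => h1 ω).trans ?_
  rw [sum_add_distrib, pr, add_mul, div_mul_cancel₀ _ (by simp)]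
  simp [mul_comm]

/-- Markov's inequality for the uniform distribution. -/
lemma pr_lt_le (f : Ω → ℝ) (hf : ∀ ω, 0 ≤ f ω) {t : ℝ} (ht : 0 < t) :
    pr (fun ω => t < f ω) ≤ (∑ ω, f ω) / Fintype.card Ω / t := by
  unfold pr
  rw [div_right_comm]
  gcongr
  rw [le_div_iff₀ ht, ← nsmul_eq_mul]
  refine le_trans ?_ (sum_le_sum_of_subset_of_nonneg (filter_subset (fun ω => t < f ω) univ)
    fun ω _ _ => hf ω)
  exact card_nsmul_le_sum _ _ _ fun ω hω => (mem_filter.1 hω).2.le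

end Probability

section RandomMap

open Finset

variable {V W : Type*} [Fintype V] [DecidableEq V] [Fintype W]

/-- Resampling a random map outside of a set of points does not change its distribution. -/
lemma pr_resample (s : Finset V) (P : (V → W) → Prop) :
    pr P = pr (fun x : (V → W) × (V → W) => P (s.piecewise x.1 x.2)) := by
  rcases isEmpty_or_nonempty (V → W) with h | h
  · simp [pr]
  let e : (V → W) × (V → W) → (V → W) × (V → W) :=
    fun x => (s.piecewise x.1 x.2, s.piecewise x.2 x.1)
  have he : Function.Involutive e := by
    rintro ⟨b, b'⟩
    ext v <;> by_cases hv : v ∈ s <;> simp [e, hv]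
  rw [← pr_fst (Ω' := V → W) P]
  exact (pr_equiv he.toPerm _).symm

lemma pr_le_of_resample (s : Finset V) {P X : (V → W) → Prop} {c : ℝ}
    (hc : 0 ≤ c) (h : ∀ b, X b ∨ pr (fun b' => P (s.piecewise b b')) ≤ c) :
    pr P ≤ pr X + c := by
  rw [pr_resample s]
  exact pr_prod_le hc h

lemma pr_apply_mem (u : V) (T : W → Prop) : pr (fun b : V → W => T (b u)) = pr T := by
  rcases isEmpty_or_nonempty W with h | h
  · have : IsEmpty (V → W) := ⟨fun f => h.false (f u)⟩
    simp [pr]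
  rw [← pr_fst (Ω' := {j // j ≠ u} → W) T]
  exact pr_equiv (Equiv.funSplitAt u W) (fun x => T x.1)

lemma pr_apply_pair {u v : V} (huv : u ≠ v) (R : W × W → Prop) :
    pr (fun b : V → W => R (b u, b v)) = pr R := by
  rcases isEmpty_or_nonempty W with h | h
  · have : IsEmpty (V → W) := ⟨fun f => h.false (f u)⟩
    simp [pr]
  rw [pr_resample {u}, pr_prod]
  have h1 : ∀ b : V → W, pr (fun b' : V → W =>
      R (({u} : Finset V).piecewise b b' u, ({u} : Finset V).piecewise b b' v)) =
      pr (fun w => R (b u, w)) := by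
    intro b
    rw [← pr_apply_mem v (fun w => R (b u, w))]
    simp [huv.symm]
  simp only [h1]
  rw [← pr_prod (fun x : (V → W) × W => R (x.1 u, x.2)), pr_prod', pr_prod' R]
  congr 1
  exact sum_congr rfl fun w _ => pr_apply_mem u (fun w' => R (w', w))

lemma pr_and_off {s : Finset V} {P Q : (V → W) → Prop}
    (hP : ∀ b b', (∀ v ∈ s, b' v = b v) → (P b → P b'))
    (hQ : ∀ b b', (∀ v ∉ s, b' v = b v) → (Q b → Q b')) :
    pr (fun b => P b ∧ Q b) = pr P * pr Q := by
  rcases isEmpty_or_nonempty (V → W) with h | h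
  · simp [pr]
  rw [pr_resample s, pr_prod]
  have h1 : ∀ b b' : V → W, (P (s.piecewise b b') ∧ Q (s.piecewise b b')) ↔ (P b ∧ Q b') := by
    intro b b'
    refine and_congr ⟨hP _ _ fun v hv => ?_, hP _ _ fun v hv => ?_⟩
      ⟨hQ _ _ fun v hv => ?_, hQ _ _ fun v hv => ?_⟩ <;> simp [hv]
  simp only [h1]
  have h2 : ∀ b : V → W, pr (fun b' => P b ∧ Q b') = (if P b then 1 else 0) * pr Q := by
    intro b
    by_cases hb : P b <;> simp [hb, pr]
  simp only [h2, ← sum_mul]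
  rw [mul_div_right_comm]
  simp [pr]

/-- The values of a random map at pairwise disjoint pairs of points are independent. -/
lemma pr_forall_pair_le {ι : Type*} (J : Finset ι) (x y : ι → V) (hxy : ∀ i ∈ J, ∀ j ∈ J, x i ≠ y j)
    (hx : Set.InjOn x J) (hy : Set.InjOn y J) (R : W × W → Prop) {κ : ℝ}
    (hR : pr R ≤ κ) : pr (fun b : V → W => ∀ j ∈ J, R (b (x j), b (y j))) ≤ κ ^ #J := by
  have hκ : 0 ≤ κ := (pr_nonneg R).trans hR
  induction J using Finset.induction_on with
  | empty => simpa using pr_le_one _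
  | insert j J hj ih =>
    rw [card_insert_of_notMem hj, pow_succ']
    have key : pr (fun b : V → W => R (b (x j), b (y j)) ∧ ∀ i ∈ J, R (b (x i), b (y i))) =
        pr (fun b : V → W => R (b (x j), b (y j))) *
        pr (fun b : V → W => ∀ i ∈ J, R (b (x i), b (y i))) := by
      refine pr_and_off (s := {x j, y j}) (fun b b' h hb => ?_) (fun b b' h hb i hi => ?_)
      · rwa [h _ (by simp), h _ (by simp)]
      · have hij : i ≠ j := fun h => hj (h ▸ hi)
        have hi' : i ∈ insert j J := mem_insert_of_mem hi
        have hj' : j ∈ insert j J := mem_insert_self _ _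
        have h1 : x i ≠ x j := fun h => hij (hx (by simpa using hi') (by simp) h)
        have h2 : y i ≠ y j := fun h => hij (hy (by simpa using hi') (by simp) h)
        rw [h _ (by simp [h1, hxy i hi' j hj']), h _ (by simp [h2, (hxy j hj' i hi').symm])]
        exact hb i hi
    simp only [forall_mem_insert]
    rw [key]
    have hsub : (J : Set ι) ⊆ (insert j J : Finset ι) := by simp
    rw [pr_apply_pair (hxy j (by simp) j (by simp))]
    refine mul_le_mul hR (ih (fun i hi k hk => hxy i (mem_insert_of_mem hi) k (mem_insert_of_mem hk))
      (hx.mono hsub) (hy.mono hsub)) (pr_nonneg _) hκ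

/-- One step of the exploration of a random map. -/
lemma pr_and_apply_mem {P : (V → W) → Prop} {u : (V → W) → V} {T : (V → W) → Finset W} {t : ℕ}
    (hP : ∀ f w, P f → P (Function.update f (u f) w))
    (hu : ∀ f w, P f → u (Function.update f (u f) w) = u f)
    (hT : ∀ f w, P f → T (Function.update f (u f) w) = T f)
    (ht : ∀ f, P f → #(T f) = t) :
    pr (fun f => P f ∧ f (u f) ∈ T f) = t / Fintype.card W * pr P := by
  rcases isEmpty_or_nonempty W with h | h
  · have : pr (fun f => P f ∧ f (u f) ∈ T f) = 0 := by
      simp [pr, filter_eq_empty_iff]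
      left
      intro f
      exact (h.false (f (u f))).elim
    simp [this]
  have key : #{f | P f ∧ f (u f) ∈ T f} * Fintype.card W = #{f | P f} * t := by
    have h1 : #{f | P f} * t = #(({f | P f} : Finset (V → W)).sigma fun f => T f) := by
      rw [card_sigma, sum_congr rfl fun f hf => ht f (mem_filter.1 hf).2]
      simp
    rw [h1, ← card_univ, ← card_product]
    refine card_nbij' (fun x => ⟨Function.update x.1 (u x.1) x.2, x.1 (u x.1)⟩)
      (fun x => (Function.update x.1 (u x.1) x.2, x.1 (u x.1))) ?_ ?_ ?_ ?_
    · rintro ⟨f, w⟩ hx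
      obtain ⟨hf, hm⟩ : P f ∧ f (u f) ∈ T f := by simpa using hx
      simpa [hT f w hf] using ⟨hP f w hf, hm⟩
    · rintro ⟨f, w⟩ hx
      obtain ⟨hf, hm⟩ : P f ∧ w ∈ T f := by simpa using hx
      simpa [hT f w hf, hu f w hf] using ⟨hP f w hf, hm⟩
    · rintro ⟨f, w⟩ hx
      obtain ⟨hf, hm⟩ : P f ∧ f (u f) ∈ T f := by simpa using hx
      simp [hu f w hf]
    · rintro ⟨f, w⟩ hx
      obtain ⟨hf, hm⟩ : P f ∧ w ∈ T f := by simpa using hx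
      simp [hu f w hf]
  unfold pr
  have hW : (Fintype.card W : ℝ) ≠ 0 := by simp
  have hVW : (Fintype.card (V → W) : ℝ) ≠ 0 := by simp
  have key' : (#{f | P f ∧ f (u f) ∈ T f} : ℝ) * Fintype.card W = #{f | P f} * t := by
    exact_mod_cast key
  field_simp
  linarith

end RandomMap
section Exploration

open Finset

variable {V : Type*} [Fintype V] [DecidableEq V]

/-- The first `r` points of the orbit of `x` under `f` and the first `s` points of the orbit
of `y` under `f` are `r + s` pairwise distinct points. -/
def DisjointOrbits {V : Type*} (f : V → V) (r s : ℕ) (x y : V) : Prop :=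
  Set.InjOn (fun i => f^[i] x) (Set.Iio r) ∧ Set.InjOn (fun i => f^[i] y) (Set.Iio s) ∧
    ∀ i < r, ∀ j < s, f^[i] x ≠ f^[j] y

/-- The first `r` points of the orbit of `x` under `f` are pairwise distinct. -/
abbrev InjOrbit {V : Type*} (f : V → V) (r : ℕ) (x : V) : Prop :=
  Set.InjOn (fun i => f^[i] x) (Set.Iio r)

lemma disjointOrbits_zero {V : Type*} (f : V → V) (s : ℕ) (x y : V) :
    DisjointOrbits f 0 s x y ↔ InjOrbit f s y := by
  simp [DisjointOrbits]

lemma DisjointOrbits.symm {V : Type*} {f : V → V} {r s : ℕ} {x y : V}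
    (h : DisjointOrbits f r s x y) : DisjointOrbits f s r y x :=
  ⟨h.2.1, h.1, fun i hi j hj => (h.2.2 j hj i hi).symm⟩

lemma iterate_eq_of_agree {V : Type*} {f g : V → V} {x : V} {m : ℕ}
    (h : ∀ i, i + 1 < m → g (f^[i] x) = f (f^[i] x)) : ∀ i < m, g^[i] x = f^[i] x := by
  intro i hi
  induction i with
  | zero => rfl
  | succ i ih =>
    rw [Function.iterate_succ_apply', Function.iterate_succ_apply', ih (by omega), h i hi]

/-- The points revealed by exploring two orbits. -/
def orbitPoints (f : V → V) (r s : ℕ) (x y : V) : Finset V :=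
  (range r).image (fun i => f^[i] x) ∪ (range s).image (fun i => f^[i] y)

omit [Fintype V] in
lemma card_orbitPoints_le (f : V → V) (r s : ℕ) (x y : V) : #(orbitPoints f r s x y) ≤ r + s := by
  refine (card_union_le _ _).trans ?_
  gcongr <;> exact card_image_le.trans (by simp)

omit [Fintype V] in
lemma DisjointOrbits.card_orbitPoints {f : V → V} {r s : ℕ} {x y : V}
    (h : DisjointOrbits f r s x y) : #(orbitPoints f r s x y) = r + s := by
  unfold orbitPoints
  rw [card_union_of_disjoint, card_image_of_injOn, card_image_of_injOn, card_range, card_range]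
  · simpa using h.2.1
  · simpa using h.1
  · rw [disjoint_left]
    intro v hv hv'
    obtain ⟨i, hi, rfl⟩ := mem_image.1 hv
    obtain ⟨j, hj, hij⟩ := mem_image.1 hv'
    exact h.2.2 i (mem_range.1 hi) j (mem_range.1 hj) hij.symm

omit [Fintype V] in
lemma disjointOrbits_succ_iff {f : V → V} {r s : ℕ} {x y : V} :
    DisjointOrbits f r (s + 1) x y ↔
      DisjointOrbits f r s x y ∧ f^[s] y ∉ orbitPoints f r s x y := by
  constructor
  · rintro ⟨h1, h2, h3⟩
    refine ⟨⟨h1, h2.mono (Set.Iio_subset_Iio (by omega)), fun i hi j hj => h3 i hi j (by omega)⟩, ?_⟩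
    simp only [orbitPoints, mem_union, mem_image, mem_range, not_or, not_exists, not_and]
    refine ⟨fun i hi => h3 i hi s (by omega), fun j hj he => ?_⟩
    have := h2 (x₁ := j) (x₂ := s) (by simp; omega) (by simp) he
    omega
  · rintro ⟨⟨h1, h2, h3⟩, h4⟩
    simp only [orbitPoints, mem_union, mem_image, mem_range, not_or, not_exists, not_and] at h4
    refine ⟨h1, ?_, ?_⟩
    · intro i hi j hj hij
      simp only [Set.mem_Iio] at hi hj
      rcases Nat.lt_succ_iff_lt_or_eq.1 hi with hi | rfl <;>
        rcases Nat.lt_succ_iff_lt_or_eq.1 hj with hj | rfl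
      · exact h2 hi hj hij
      · exact (h4.2 i hi hij).elim
      · exact (h4.2 j hj hij.symm).elim
      · rfl
    · intro i hi j hj
      rcases Nat.lt_succ_iff_lt_or_eq.1 hj with hj | rfl
      · exact h3 i hi j hj
      · exact h4.1 i hi

lemma pr_disjointOrbits_succ (r s : ℕ) (hs : 1 ≤ s) (x y : V) :
    pr (fun f : V → V => DisjointOrbits f r (s + 1) x y) =
      (1 - (r + s : ℝ) / Fintype.card V) * pr (fun f : V → V => DisjointOrbits f r s x y) := by
  obtain ⟨s, rfl⟩ : ∃ t, s = t + 1 := ⟨s - 1, by omega⟩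
  have hV : (Fintype.card V : ℝ) ≠ 0 := by
    have : Nonempty V := ⟨x⟩
    simp
  have agree : ∀ (f : V → V) (w : V), DisjointOrbits f r (s + 1) x y →
      (∀ i < r, (Function.update f (f^[s] y) w)^[i] x = f^[i] x) ∧
      (∀ i < s + 1, (Function.update f (f^[s] y) w)^[i] y = f^[i] y) := by
    intro f w h
    refine ⟨iterate_eq_of_agree fun i hi => ?_, iterate_eq_of_agree fun i hi => ?_⟩
    · rw [Function.update_of_ne]
      exact h.2.2 i (by omega) s (by omega)
    · rw [Function.update_of_ne]
      intro he
      have := h.2.1 (x₁ := i) (x₂ := s) (by simp; omega) (by simp) he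
      omega
  have hO : ∀ (f : V → V) (w : V), DisjointOrbits f r (s + 1) x y →
      orbitPoints (Function.update f (f^[s] y) w) r (s + 1) x y = orbitPoints f r (s + 1) x y := by
    intro f w h
    obtain ⟨h1, h2⟩ := agree f w h
    unfold orbitPoints
    congr 1
    · exact image_congr fun i hi => h1 i (by simpa using hi)
    · exact image_congr fun i hi => h2 i (by simpa using hi)
  have key := pr_and_apply_mem (P := fun f : V → V => DisjointOrbits f r (s + 1) x y)
    (u := fun f => f^[s] y) (T := fun f => (orbitPoints f r (s + 1) x y)ᶜ)
    (t := Fintype.card V - (r + (s + 1))) ?_ ?_ ?_ ?_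
  · have h1 : ∀ f : V → V, (DisjointOrbits f r (s + 1 + 1) x y ↔ DisjointOrbits f r (s + 1) x y ∧
        f (f^[s] y) ∈ (orbitPoints f r (s + 1) x y)ᶜ) := by
      intro f
      rw [disjointOrbits_succ_iff, mem_compl, Function.iterate_succ_apply']
    simp only [h1]
    rw [key]
    by_cases hle : r + (s + 1) ≤ Fintype.card V
    · rw [Nat.cast_sub hle]
      push_cast
      field_simp
    · have : pr (fun f : V → V => DisjointOrbits f r (s + 1) x y) = 0 := by
        have : ∀ f : V → V, ¬ DisjointOrbits f r (s + 1) x y := fun f h =>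
          hle (h.card_orbitPoints ▸ card_le_univ _)
        simp [pr, this]
      simp [this]
  · intro f w h
    obtain ⟨h1, h2⟩ := agree f w h
    refine ⟨fun i hi j hj hij => ?_, fun i hi j hj hij => ?_, fun i hi j hj => ?_⟩
    · beta_reduce at hij
      rw [h1 i hi, h1 j hj] at hij
      exact h.1 hi hj hij
    · beta_reduce at hij
      rw [h2 i hi, h2 j hj] at hij
      exact h.2.1 hi hj hij
    · rw [h1 i hi, h2 j hj]
      exact h.2.2 i hi j hj
  · exact fun f w h => (agree f w h).2 s (by omega)
  · intro f w h
    rw [hO f w h]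
  · intro f h
    rw [card_compl, h.card_orbitPoints]

lemma pr_not_disjointOrbits_succ_le (r s : ℕ) (x y : V) :
    pr (fun f : V → V => ¬ DisjointOrbits f r (s + 1) x y) ≤
      pr (fun f : V → V => ¬ DisjointOrbits f r 1 x y) + s * (r + s) / Fintype.card V := by
  have : Nonempty V := ⟨x⟩
  induction s with
  | zero => simp
  | succ s ih =>
    have h1 := pr_disjointOrbits_succ r (s + 1) (by omega) x y
    have h2 := pr_add_not (fun f : V → V => DisjointOrbits f r (s + 1) x y)
    have h3 := pr_add_not (fun f : V → V => DisjointOrbits f r (s + 1 + 1) x y)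
    have h4 : (r + (s + 1 : ℕ) : ℝ) / Fintype.card V *
        pr (fun f : V → V => DisjointOrbits f r (s + 1) x y) ≤
        (r + (s + 1 : ℕ) : ℝ) / Fintype.card V :=
      mul_le_of_le_one_right (by positivity) (pr_le_one _)
    have h5 : (s * (r + s) : ℝ) / Fintype.card V + (r + (s + 1 : ℕ) : ℝ) / Fintype.card V ≤
        ((s + 1 : ℕ) * (r + (s + 1 : ℕ))) / Fintype.card V := by
      rw [← add_div]
      gcongr
      push_cast
      nlinarith
    rw [sub_mul, one_mul] at h1
    linarith

lemma pr_not_injOrbit_le (k : ℕ) (x : V) :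
    pr (fun f : V → V => ¬ InjOrbit f k x) ≤ k ^ 2 / Fintype.card V := by
  rcases k with _ | k
  · simp [pr, Set.InjOn]
  have h := pr_not_disjointOrbits_succ_le 0 k x x
  have h0 : pr (fun f : V → V => ¬ InjOrbit f 1 x) = 0 := by
    simp [pr, Set.InjOn]
  simp only [disjointOrbits_zero, h0] at h
  refine h.trans ?_
  rw [zero_add]
  gcongr
  push_cast
  nlinarith

lemma pr_injOrbit_le (k : ℕ) (x : V) :
    pr (fun f : V → V => InjOrbit f (k + 1) x) ≤
      Real.exp (-(k * (k + 1) / (2 * Fintype.card V))) := by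
  induction k with
  | zero => simpa using pr_le_one _
  | succ k ih =>
    have h := pr_disjointOrbits_succ 0 (k + 1) (by omega) x x
    simp only [disjointOrbits_zero] at h
    rw [h]
    have h1 := Real.one_sub_le_exp_neg (((0 : ℕ) + (k + 1 : ℕ) : ℝ) / Fintype.card V)
    refine (mul_le_mul h1 ih (pr_nonneg _) (Real.exp_nonneg _)).trans (le_of_eq ?_)
    rw [← Real.exp_add]
    have : Nonempty V := ⟨x⟩
    have hV : (Fintype.card V : ℝ) ≠ 0 := by simp
    congr 1
    push_cast
    field_simp
    ring

lemma pr_le_of_forall_right {Ω Ω' : Type*} [Fintype Ω] [Fintype Ω'] {P : Ω × Ω' → Prop} {c : ℝ}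
    (hc : 0 ≤ c) (h : ∀ ω', pr (fun ω => P (ω, ω')) ≤ c) : pr P ≤ c := by
  rw [pr_prod']
  refine div_le_of_le_mul₀ (by positivity) hc ((sum_le_sum fun ω _ => h ω).trans ?_)
  simp [mul_comm]

lemma pr_le_of_forall_left {Ω Ω' : Type*} [Fintype Ω] [Fintype Ω'] {P : Ω × Ω' → Prop} {c : ℝ}
    (hc : 0 ≤ c) (h : ∀ ω, pr (fun ω' => P (ω, ω')) ≤ c) : pr P ≤ c := by
  rw [pr_prod]
  refine div_le_of_le_mul₀ (by positivity) hc ((sum_le_sum fun ω _ => h ω).trans ?_)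
  simp [mul_comm]

/-- Under a random map, the orbits of two random points are disjoint with high probability. -/
lemma pr_not_disjointOrbits_le (r : ℕ) :
    pr (fun x : (V → V) × (V × V) => ¬ DisjointOrbits x.1 r r x.2.1 x.2.2) ≤
      4 * r ^ 2 / Fintype.card V := by
  rcases isEmpty_or_nonempty V with hV | hV
  · simp [pr]
  rcases r with _ | r
  · simp [pr, DisjointOrbits]
  have h1 : pr (fun x : (V → V) × (V × V) => ¬ DisjointOrbits x.1 (r + 1) 1 x.2.1 x.2.2) ≤
      ((r + 1 : ℕ) ^ 2 + (r + 1 : ℕ)) / Fintype.card V := by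
    rw [add_div]
    refine le_trans (pr_mono (Q := fun x => ¬ InjOrbit x.1 (r + 1) x.2.1 ∨
      x.2.2 ∈ orbitPoints x.1 (r + 1) 0 x.2.1 x.2.1) ?_) ((pr_or_le _ _).trans (add_le_add ?_ ?_))
    · rintro ⟨f, x, y⟩ h
      by_contra! h'
      refine h (disjointOrbits_succ_iff.2 ⟨?_, ?_⟩)
      · simpa [DisjointOrbits] using h'.1
      · simpa [orbitPoints] using h'.2
    · exact pr_le_of_forall_right (by positivity) fun x => pr_not_injOrbit_le (r + 1) x.1
    · refine pr_le_of_forall_left (by positivity) fun f => ?_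
      refine pr_le_of_forall_left (by positivity) fun x => ?_
      have h := card_orbitPoints_le f (r + 1) 0 x x
      refine (pr_mem (orbitPoints f (r + 1) 0 x x)).trans_le ?_
      gcongr
  rw [pr_prod'] at h1 ⊢
  have h2 := sum_le_sum fun (x : V × V) (_ : x ∈ univ) =>
    pr_not_disjointOrbits_succ_le (r + 1) r x.1 x.2
  rw [sum_add_distrib] at h2
  have hc : (0 : ℝ) < Fintype.card (V × V) := by simp [Fintype.card_pos]
  have h3 := div_le_div_of_nonneg_right h2 hc.le
  rw [add_div, sum_const, nsmul_eq_mul, card_univ, mul_div_cancel_left₀ _ hc.ne'] at h3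
  refine h3.trans ((add_le_add_left h1 _).trans ?_)
  rw [← add_div]
  gcongr
  push_cast
  nlinarith

end Exploration
section CyclicPoints

open Finset Function

variable {V : Type*} [Fintype V] [DecidableEq V]

/-- The cyclic points of a map. -/
noncomputable def cyclicPoints (f : V → V) : Finset V := {x | x ∈ periodicPts f}

omit [Fintype V] [DecidableEq V] in
lemma exists_enumeration [Nonempty V] (C : Finset V) :
    ∃ c : ℕ → V, Set.BijOn c (Set.Iio #C) C := by
  refine ⟨fun i => if h : i < #C then (C.equivFin.symm ⟨i, h⟩ : V) else Classical.arbitrary V,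
    fun i hi => ?_, fun i hi j hj hij => ?_, fun x hx => ?_⟩
  · rw [Set.mem_Iio] at hi
    simp [hi]
  · rw [Set.mem_Iio] at hi hj
    simpa [hi, hj, Subtype.coe_inj] using hij
  · refine ⟨C.equivFin ⟨x, hx⟩, by simp, by simp⟩

omit [DecidableEq V] in
/-- The action of a map on its cyclic points can be unfolded into a single path. -/
lemma exists_path_of_cyclicPoints [Nonempty V] (f : V → V) (c : ℕ → V)
    (hc : Set.BijOn c (Set.Iio #(cyclicPoints f)) (cyclicPoints f)) :
    ∃ (g : V → V) (v : V), (∀ i < #(cyclicPoints f), g^[i] v = f (c i)) ∧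
      ∀ x ∉ cyclicPoints f, g x = f x := by
  set m := #(cyclicPoints f) with hm
  have hf : Set.BijOn f (cyclicPoints f) (cyclicPoints f) := by
    simpa [cyclicPoints] using bijOn_periodicPts f
  have hfc := hf.comp hc
  let g : V → V := fun x =>
    if h : ∃ i, i + 1 < m ∧ f (c i) = x then f (c (h.choose + 1)) else f x
  refine ⟨g, f (c 0), fun i hi => ?_, fun x hx => ?_⟩
  · induction i with
    | zero => rfl
    | succ i ih =>
      rw [iterate_succ_apply', ih (by omega)]
      have h : ∃ j, j + 1 < m ∧ f (c j) = f (c i) := ⟨i, hi, rfl⟩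
      have hj : h.choose = i := hfc.injOn (by have := h.choose_spec.1; simp; omega)
        (by simp; omega) h.choose_spec.2
      simp only [g]
      rw [dif_pos h, hj]
  · simp only [g]
    rw [dif_neg]
    rintro ⟨i, hi, rfl⟩
    exact hx (hfc.mapsTo (x := i) (by simp; omega))

lemma pr_card_cyclicPoints_le [Nonempty V] {k : ℕ} {c : ℝ}
    (h : ∀ v, pr (fun f : V → V => InjOrbit f k v) ≤ c) :
    pr (fun f : V → V => k ≤ #(cyclicPoints f)) ≤
      Fintype.card V * (Fintype.card V + 1) * c := by
  choose e he using fun C : Finset V => exists_enumeration C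
  choose g v hg hgo using fun f : V → V =>
    exists_path_of_cyclicPoints f (e (cyclicPoints f)) (he _)
  have hbij : ∀ f, Set.BijOn (fun i => (g f)^[i] (v f)) (Set.Iio #(cyclicPoints f))
      (cyclicPoints f) := by
    intro f
    have hf : Set.BijOn f (cyclicPoints f) (cyclicPoints f) := by
      simpa [cyclicPoints] using bijOn_periodicPts f
    exact (hf.comp (he _)).congr fun i hi => (hg f i hi).symm
  let Φ : (V → V) → (V → V) × (V × Fin (Fintype.card V + 1)) := fun f =>
    (g f, v f, ⟨#(cyclicPoints f), Nat.lt_succ_of_le (card_le_univ _)⟩)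
  have hΦ : Injective Φ := by
    intro f f' hff
    simp only [Φ, Prod.mk.injEq, Fin.mk.injEq] at hff
    obtain ⟨h1, h2, h3⟩ := hff
    have hC : cyclicPoints f = cyclicPoints f' := by
      rw [← coe_inj, ← (hbij f).image_eq, ← (hbij f').image_eq, h1, h2, h3]
    ext x
    by_cases hx : x ∈ cyclicPoints f
    · obtain ⟨i, hi, rfl⟩ := (he (cyclicPoints f)).surjOn hx
      rw [← hg f i hi, h1, h2, hg f' i (h3 ▸ hi), hC]
    · rw [← hgo f x hx, h1, hgo f' x (hC ▸ hx)]
  have hcard := pr_mul_card_le_of_injective hΦ (P := fun f => k ≤ #(cyclicPoints f))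
    (Q := fun x => InjOrbit x.1 k x.2.1)
    fun f hf => (hbij f).injOn.mono (Set.Iio_subset_Iio hf)
  have hc : 0 ≤ c := (pr_nonneg _).trans (h (Classical.arbitrary V))
  have h2 : pr (fun x : (V → V) × (V × Fin (Fintype.card V + 1)) => InjOrbit x.1 k x.2.1) ≤ c :=
    pr_le_of_forall_right hc fun x => h x.1
  have hN : (0 : ℝ) < Fintype.card (V → V) := by exact_mod_cast Fintype.card_pos
  refine le_of_mul_le_mul_right (hcard.trans ((mul_le_mul_of_nonneg_right h2
    (Nat.cast_nonneg _)).trans (le_of_eq ?_))) hN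
  rw [Fintype.card_prod, Fintype.card_prod, Fintype.card_fin]
  push_cast
  ring

lemma image_iterate_subset_cyclicPoints {f : V → V} {K : ℕ} (h : ∀ x, ¬ InjOrbit f (K + 1) x) :
    univ.image f^[K] ⊆ cyclicPoints f := by
  have key : ∀ x, ∀ i j, i < j → j ≤ K → f^[i] x = f^[j] x → f^[K] x ∈ cyclicPoints f := by
    intro x i j hij hj he
    simp only [cyclicPoints, mem_filter, mem_univ, true_and]
    refine mk_mem_periodicPts (n := j - i) (by omega) ?_
    have h1 : f^[j - i] (f^[i] x) = f^[i] x := by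
      rw [← iterate_add_apply, he, Nat.sub_add_cancel hij.le]
    have h2 : f^[K] x = f^[K - i] (f^[i] x) := by
      rw [← iterate_add_apply, Nat.sub_add_cancel (by omega)]
    rw [h2]
    exact IsPeriodicPt.apply_iterate h1 _
  intro y hy
  obtain ⟨x, -, rfl⟩ := mem_image.1 hy
  have hx := h x
  simp only [InjOrbit, Set.InjOn, not_forall] at hx
  obtain ⟨i, hi, j, hj, he, hij⟩ := hx
  rw [Set.mem_Iio] at hi hj
  rcases lt_or_gt_of_ne hij with h | h
  · exact key x i j h (by omega) he
  · exact key x j i h (by omega) he.symm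

/-- The image of the `K`-th iterate of a random map is small when `K` is a bit larger
than the square root of the number of points. -/
lemma pr_lt_card_image_iterate_le [Nonempty V] (K : ℕ) :
    pr (fun f : V → V => K < #(univ.image f^[K])) ≤
      Fintype.card V * (Fintype.card V + 2) *
        Real.exp (-(K * (K + 1) / (2 * Fintype.card V))) := by
  refine le_trans (pr_mono (Q := fun f : V → V => (∃ x ∈ (univ : Finset V), InjOrbit f (K + 1) x) ∨
    K + 1 ≤ #(cyclicPoints f)) ?_) ((pr_or_le _ _).trans ((add_le_add ((pr_exists_le _ _).trans
      (sum_le_sum fun x _ => pr_injOrbit_le K x))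
      (pr_card_cyclicPoints_le (pr_injOrbit_le K))).trans (le_of_eq ?_)))
  · intro f hf
    by_contra! h
    have := card_le_card (image_iterate_subset_cyclicPoints fun x => h.1 x (mem_univ x))
    omega
  · rw [sum_const, card_univ, nsmul_eq_mul]
    ring

end CyclicPoints
section Selection

open Finset

variable {V : Type*} [Fintype V] [DecidableEq V]

omit [Fintype V] in
lemma exists_disjoint_pairs {s t : ℕ → V} {l : ℕ} (hs : Set.InjOn s (Set.Iio l))
    (ht : Set.InjOn t (Set.Iio l)) (hst : ∀ i < l, s i ≠ t i) (E : Finset V) (N : ℕ)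
    (hN : 3 * N + 2 * #E ≤ l) :
    ∃ I ⊆ range l, #I = N ∧ (∀ i ∈ I, s i ∉ E ∧ t i ∉ E) ∧ ∀ i ∈ I, ∀ j ∈ I, s i ≠ t j := by
  have count : ∀ (u : ℕ → V), Set.InjOn u (Set.Iio l) → ∀ T : Finset V,
      #{i ∈ range l | u i ∈ T} ≤ #T := by
    intro u hu T
    refine card_le_card_of_injOn u (fun i hi => (mem_filter.1 hi).2) (hu.mono fun i hi => ?_)
    simpa using (mem_filter.1 hi).1
  induction N with
  | zero => exact ⟨∅, by simp, by simp, by simp, by simp⟩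
  | succ N ih =>
    obtain ⟨I, hI, hcard, hE, hd⟩ := ih (by omega)
    have hlt : #({i ∈ range l | s i ∈ E ∪ I.image t} ∪ ({i ∈ range l | t i ∈ E ∪ I.image s} ∪ I)) <
        #(range l) := by
      have h1 := count s hs (E ∪ I.image t)
      have h2 := count t ht (E ∪ I.image s)
      have h3 : #(E ∪ I.image t) ≤ #E + N :=
        (card_union_le _ _).trans (by have := card_image_le (s := I) (f := t); omega)
      have h4 : #(E ∪ I.image s) ≤ #E + N :=
        (card_union_le _ _).trans (by have := card_image_le (s := I) (f := s); omega)
      refine (card_union_le _ _).trans_lt ?_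
      have h5 := card_union_le ({i ∈ range l | t i ∈ E ∪ I.image s}) I
      rw [card_range]
      omega
    obtain ⟨k, hk, hk'⟩ := exists_mem_notMem_of_card_lt_card hlt
    simp only [mem_union, mem_filter, hk, true_and, not_or, mem_image, not_exists, not_and] at hk'
    obtain ⟨⟨h1, h2⟩, ⟨h3, h4⟩, h5⟩ := hk'
    refine ⟨insert k I, insert_subset hk hI, by rw [card_insert_of_notMem h5, hcard], ?_, ?_⟩
    · rw [forall_mem_insert]
      exact ⟨⟨h1, h3⟩, hE⟩
    · simp only [forall_mem_insert]
      exact ⟨⟨hst k (by simpa using hk), fun j hj he => h2 j hj he.symm⟩,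
        fun i hi => ⟨fun he => h4 i hi he, hd i hi⟩⟩

lemma pr_ne_le_of_card_image_le [Nonempty V] (F : V → V) {K : ℕ} (hK : #(univ.image F) ≤ K) :
    pr (fun z : V × V => F z.1 ≠ F z.2) ≤ 1 - 1 / K := by
  have hne : (univ.image F).Nonempty := univ_nonempty.image F
  have hK0 : (0 : ℝ) < K := by exact_mod_cast hne.card_pos.trans_le hK
  have hV : (0 : ℝ) < Fintype.card V := by exact_mod_cast Fintype.card_pos
  have h1 : (Fintype.card V : ℝ) = ∑ c ∈ univ.image F, (#{x | F x = c} : ℝ) := by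
    rw [← card_univ, card_eq_sum_card_image F univ]
    push_cast
    rfl
  have h2 : (#{z : V × V | F z.1 = F z.2} : ℝ) = ∑ c ∈ univ.image F, (#{x | F x = c} : ℝ) ^ 2 := by
    rw [card_eq_sum_card_fiberwise (f := fun z : V × V => F z.1) (t := univ.image F)
      (fun z _ => by simp)]
    push_cast
    refine sum_congr rfl fun c _ => ?_
    rw [sq, ← Nat.cast_mul, ← card_product, Nat.cast_inj]
    congr 1
    ext ⟨x, y⟩
    simp only [mem_filter, mem_univ, true_and, mem_product]
    constructor
    · rintro ⟨h, rfl⟩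
      exact ⟨rfl, h.symm⟩
    · rintro ⟨rfl, h⟩
      exact ⟨h.symm, rfl⟩
  have h3 := sq_sum_le_card_mul_sum_sq (s := univ.image F) (f := fun c => (#{x | F x = c} : ℝ))
  rw [← h1, ← h2] at h3
  have h4 : (Fintype.card V : ℝ) ^ 2 ≤ K * #{z : V × V | F z.1 = F z.2} :=
    h3.trans (by gcongr)
  have h5 := pr_add_not (fun z : V × V => F z.1 = F z.2)
  have h6 : 1 / (K : ℝ) ≤ pr (fun z : V × V => F z.1 = F z.2) := by
    have h7 := pr_mul_card (fun z : V × V => F z.1 = F z.2)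
    rw [Fintype.card_prod] at h7
    push_cast at h7
    rw [div_le_iff₀ hK0]
    have h8 : (Fintype.card V : ℝ) ^ 2 ≤ K * (pr (fun z : V × V => F z.1 = F z.2) *
        (Fintype.card V * Fintype.card V)) := by
      rw [h7]
      convert h4
    have : 0 < (Fintype.card V : ℝ) ^ 2 := by positivity
    by_contra! hcon
    nlinarith
  change pr (fun z : V × V => ¬ F z.1 = F z.2) ≤ _
  linarith

/-- A point that is `J`-related to all points but a proportion `θ`. -/
def IsLight (J : V → V → Prop) (θ : ℝ) (z : V) : Prop := pr (fun z' => ¬ J z z') ≤ θ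

/-- The points `x i` and `y i`, for `i ∈ I`, are light and pairwise `J`-related. -/
def IsAccepted {ι : Type*} (J : V → V → Prop) (θ : ℝ) (x y : ι → V) (I : Finset ι) : Prop :=
  (∀ i ∈ I, IsLight J θ (x i) ∧ IsLight J θ (y i) ∧ J (x i) (y i)) ∧
  ∀ i ∈ I, ∀ j ∈ I, i ≠ j → J (x i) (x j) ∧ J (x i) (y j) ∧ J (y i) (x j) ∧ J (y i) (y j)

/-- The pair `w` cannot be added to the set `Z` of light points. -/
def IsRejected (J : V → V → Prop) (θ : ℝ) (Z : Finset V) (w : V × V) : Prop :=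
  (¬ IsLight J θ w.1 ∨ ¬ IsLight J θ w.2) ∨ ¬ J w.1 w.2 ∨
    ∃ z ∈ Z, IsLight J θ z ∧ (¬ J z w.1 ∨ ¬ J z w.2)

omit [DecidableEq V] in
lemma pr_isRejected_le [Nonempty V] (J : V → V → Prop) {θ η : ℝ} (hθ : 0 < θ)
    (hJ : pr (fun z : V × V => ¬ J z.1 z.2) ≤ η) (Z : Finset V) :
    pr (IsRejected J θ Z) ≤ 2 * (η / θ) + η + #Z * (2 * θ) := by
  have hη : 0 ≤ η := (pr_nonneg _).trans hJ
  have hlight : pr (fun z => ¬ IsLight J θ z) ≤ η / θ := by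
    simp only [IsLight, not_le]
    refine (pr_lt_le _ (fun z => pr_nonneg _) hθ).trans ?_
    gcongr
    rw [← pr_prod (fun z : V × V => ¬ J z.1 z.2)]
    exact hJ
  have h1 : pr (fun w : V × V => ¬ IsLight J θ w.1) ≤ η / θ := by
    rwa [pr_fst (Ω' := V) fun z => ¬ IsLight J θ z]
  have h2 : pr (fun w : V × V => ¬ IsLight J θ w.2) ≤ η / θ :=
    pr_le_of_forall_left (by positivity) fun _ => hlight
  have h3 : ∀ z ∈ Z, pr (fun w : V × V => IsLight J θ z ∧ (¬ J z w.1 ∨ ¬ J z w.2)) ≤ 2 * θ := by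
    intro z _
    by_cases hz : IsLight J θ z
    · simp only [hz, true_and]
      refine (pr_or_le _ _).trans ?_
      rw [two_mul]
      refine add_le_add ?_ (pr_le_of_forall_left hθ.le fun _ => hz)
      rw [pr_fst (Ω' := V) fun z' => ¬ J z z']
      exact hz
    · simp [hz, pr, hθ.le]
  have h4 : pr (fun w : V × V => ∃ z ∈ Z, IsLight J θ z ∧ (¬ J z w.1 ∨ ¬ J z w.2)) ≤
      #Z * (2 * θ) := by
    refine (pr_exists_le _ _).trans ((sum_le_sum h3).trans ?_)
    rw [sum_const, nsmul_eq_mul]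
  have h5 := pr_or_le (fun w : V × V => ¬ IsLight J θ w.1) (fun w => ¬ IsLight J θ w.2)
  have h6 := pr_or_le (fun w : V × V => ¬ J w.1 w.2)
    (fun w => ∃ z ∈ Z, IsLight J θ z ∧ (¬ J z w.1 ∨ ¬ J z w.2))
  have h7 := pr_or_le (fun w : V × V => ¬ IsLight J θ w.1 ∨ ¬ IsLight J θ w.2)
    (fun w => ¬ J w.1 w.2 ∨ ∃ z ∈ Z, IsLight J θ z ∧ (¬ J z w.1 ∨ ¬ J z w.2))
  change pr (fun w => IsRejected J θ Z w) ≤ _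
  unfold IsRejected
  linarith

lemma exists_isRejected_of_not_isAccepted {ι : Type*} {J : V → V → Prop} (hJ : ∀ u v, J u v → J v u)
    {θ : ℝ} {x y : ι → V} {L : Finset ι} {m : ℕ}
    (h : ∀ I ⊆ L, m ≤ #I → ¬ IsAccepted J θ x y I) :
    ∃ I ∈ L.powerset, #I < m ∧
      ∀ j ∈ L \ I, IsRejected J θ (I.image x ∪ I.image y) (x j, y j) := by
  let A : Finset (Finset ι) := {I ∈ L.powerset | IsAccepted J θ x y I}
  have hA : A.Nonempty := ⟨∅, mem_filter.2 ⟨by simp, by simp [IsAccepted]⟩⟩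
  obtain ⟨I, hIA, hmax⟩ := A.exists_max_image card hA
  obtain ⟨hIL, hacc⟩ := mem_filter.1 hIA
  refine ⟨I, hIL, not_le.1 fun hle => h I (mem_powerset.1 hIL) hle hacc, fun j hj => ?_⟩
  obtain ⟨hjL, hjI⟩ := mem_sdiff.1 hj
  by_contra hrej
  have hnot : insert j I ∉ A := fun hin => by
    have := hmax _ hin
    rw [card_insert_of_notMem hjI] at this
    omega
  refine hnot (mem_filter.2 ⟨mem_powerset.2 (insert_subset hjL (mem_powerset.1 hIL)), ?_⟩)
  simp only [IsRejected, not_or, not_not, not_exists, not_and] at hrej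
  obtain ⟨⟨hx, hy⟩, hxy, hZ⟩ := hrej
  have hZx : ∀ i ∈ I, J (x i) (x j) ∧ J (x i) (y j) := fun i hi =>
    hZ (x i) (mem_union_left _ (mem_image_of_mem x hi)) (hacc.1 i hi).1
  have hZy : ∀ i ∈ I, J (y i) (x j) ∧ J (y i) (y j) := fun i hi =>
    hZ (y i) (mem_union_right _ (mem_image_of_mem y hi)) (hacc.1 i hi).2.1
  refine ⟨?_, ?_⟩
  · rw [forall_mem_insert]
    exact ⟨⟨hx, hy, hxy⟩, hacc.1⟩
  · simp only [forall_mem_insert]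
    refine ⟨⟨fun h => (h rfl).elim, fun i hi _ => ?_⟩, fun i hi => ⟨fun _ => ?_, hacc.2 i hi⟩⟩
    · exact ⟨hJ _ _ (hZx i hi).1, hJ _ _ (hZy i hi).1, hJ _ _ (hZx i hi).2, hJ _ _ (hZy i hi).2⟩
    · exact ⟨(hZx i hi).1, (hZx i hi).2, (hZy i hi).1, (hZy i hi).2⟩

/-- Among `2 * m` random pairs of points, at least `m` are accepted with high probability. -/
lemma pr_forall_not_isAccepted_le {ι : Type*} {J : V → V → Prop} (hJ : ∀ u v, J u v → J v u) {θ κ : ℝ}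
    (hκ1 : κ ≤ 1) {m : ℕ}
    (hκ : ∀ Z : Finset V, #Z ≤ 2 * m → pr (IsRejected J θ Z) ≤ κ)
    {L : Finset ι} (hL : #L = 2 * m) {s t : ι → V} (hst : ∀ i ∈ L, ∀ j ∈ L, s i ≠ t j)
    (hs : Set.InjOn s L) (ht : Set.InjOn t L) :
    pr (fun b : V → V => ∀ I ⊆ L, m ≤ #I → ¬ IsAccepted J θ (fun i => b (s i)) (fun i => b (t i)) I)
      ≤ (4 * κ) ^ m := by
  have hκ0 : 0 ≤ κ := (pr_nonneg _).trans (hκ ∅ (by simp))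
  refine le_trans (pr_mono fun b hb => exists_isRejected_of_not_isAccepted hJ hb)
    ((pr_exists_le _ _).trans ?_)
  have key : ∀ I ∈ L.powerset, pr (fun b : V → V => #I < m ∧ ∀ j ∈ L \ I,
      IsRejected J θ (I.image (fun i => b (s i)) ∪ I.image fun i => b (t i)) (b (s j), b (t j))) ≤
      κ ^ m := by
    intro I hI
    rw [mem_powerset] at hI
    by_cases hIm : #I < m
    swap
    · simp [hIm, pr, pow_nonneg hκ0 m]
    simp only [hIm, true_and]
    have hsd : Set.InjOn s (L \ I : Finset ι) := hs.mono (by simp)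
    have htd : Set.InjOn t (L \ I : Finset ι) := ht.mono (by simp)
    have hstd : ∀ i ∈ L \ I, ∀ j ∈ L \ I, s i ≠ t j :=
      fun i hi j hj => hst i (mem_sdiff.1 hi).1 j (mem_sdiff.1 hj).1
    have := pr_le_of_resample (I.image s ∪ I.image t) (X := fun _ => False) (pow_nonneg hκ0 m)
      (P := fun b : V → V => ∀ j ∈ L \ I,
      IsRejected J θ (I.image (fun i => b (s i)) ∪ I.image fun i => b (t i)) (b (s j), b (t j)))
      fun b => Or.inr ?_
    · simpa [pr] using this
    have h1 := pr_forall_pair_le (W := V) (L \ I) s t hstd hsd htd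
      (IsRejected J θ (I.image (fun i => b (s i)) ∪ I.image fun i => b (t i))) (hκ _ ?_)
    · refine le_trans (pr_mono fun b' hb' j hj => ?_) (h1.trans ?_)
      · have h2 := hb' j hj
        obtain ⟨hjL, hjI⟩ := mem_sdiff.1 hj
        have e1 : s j ∉ I.image s ∪ I.image t := by
          simp only [mem_union, mem_image, not_or, not_exists, not_and]
          exact ⟨fun i hi he => hjI (hs (hI hi) hjL he ▸ hi), fun i hi he => hst j hjL i (hI hi) he.symm⟩
        have e2 : t j ∉ I.image s ∪ I.image t := by
          simp only [mem_union, mem_image, not_or, not_exists, not_and]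
          exact ⟨fun i hi he => hst i (hI hi) j hjL he, fun i hi he => hjI (ht (hI hi) hjL he ▸ hi)⟩
        rw [piecewise_eq_of_notMem _ _ _ e1, piecewise_eq_of_notMem _ _ _ e2] at h2
        have e3 : I.image (fun i => (I.image s ∪ I.image t).piecewise b b' (s i)) =
            I.image (fun i => b (s i)) := image_congr fun i hi =>
          piecewise_eq_of_mem _ _ _ (mem_union_left _ (mem_image_of_mem s hi))
        have e4 : I.image (fun i => (I.image s ∪ I.image t).piecewise b b' (t i)) =
            I.image (fun i => b (t i)) := image_congr fun i hi =>
          piecewise_eq_of_mem _ _ _ (mem_union_right _ (mem_image_of_mem t hi))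
        rwa [e3, e4] at h2
      · refine pow_le_pow_of_le_one hκ0 hκ1 ?_
        rw [card_sdiff_of_subset hI]
        omega
    · refine (card_union_le _ _).trans ?_
      have h2 := card_image_le (s := I) (f := fun i => b (s i))
      have h3 := card_image_le (s := I) (f := fun i => b (t i))
      omega
  refine (sum_le_sum key).trans (le_of_eq ?_)
  rw [sum_const, card_powerset, hL, nsmul_eq_mul, mul_pow, pow_mul]
  norm_num

end Selection
section Merging

open Finset

variable {V : Type*} [Fintype V] [DecidableEq V]

/-- If the random map `b` is exposed on `E`, and many disjoint orbit segments of `a` are already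
known, then a merging step is likely to be found along these segments. -/
lemma pr_forall_ne_of_isAccepted_le [Nonempty V] {ι : Type*} (a : V → V) {K : ℕ}
    (hK : #(univ.image a^[K]) ≤ K) {r N : ℕ} {θ : ℝ} {x y : ι → V} {I : Finset ι}
    (hI : IsAccepted (DisjointOrbits a r r) θ x y I) (E : Finset V) (hN : 2 * #E + N ≤ #I * r)
    (c : V → V) :
    pr (fun b : V → V => ∀ i ∈ I, ∀ k < r, a^[K] (E.piecewise c b (a^[k] (x i))) ≠
      a^[K] (E.piecewise c b (a^[k] (y i)))) ≤ (1 - 1 / K) ^ N := by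
  let X : ι × ℕ → V := fun z => a^[z.2] (x z.1)
  let Y : ι × ℕ → V := fun z => a^[z.2] (y z.1)
  have hX : Set.InjOn X (I ×ˢ range r : Finset (ι × ℕ)) := by
    rintro ⟨i, k⟩ hi ⟨j, l⟩ hj h
    simp only [coe_product, Set.mem_prod, mem_coe, mem_range] at hi hj
    by_cases hij : i = j
    · subst hij
      have := (hI.1 i hi.1).2.2.1 hi.2 hj.2 h
      rw [this]
    · exact ((hI.2 i hi.1 j hj.1 hij).1.2.2 k hi.2 l hj.2 h).elim
  have hY : Set.InjOn Y (I ×ˢ range r : Finset (ι × ℕ)) := by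
    rintro ⟨i, k⟩ hi ⟨j, l⟩ hj h
    simp only [coe_product, Set.mem_prod, mem_coe, mem_range] at hi hj
    by_cases hij : i = j
    · subst hij
      have := (hI.1 i hi.1).2.2.2.1 hi.2 hj.2 h
      rw [this]
    · exact ((hI.2 i hi.1 j hj.1 hij).2.2.2.2.2 k hi.2 l hj.2 h).elim
  have hXY : ∀ z ∈ I ×ˢ range r, ∀ w ∈ I ×ˢ range r, X z ≠ Y w := by
    rintro ⟨i, k⟩ hi ⟨j, l⟩ hj
    simp only [mem_product, mem_range] at hi hj
    by_cases hij : i = j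
    · subst hij
      exact (hI.1 i hi.1).2.2.2.2 k hi.2 l hj.2
    · exact (hI.2 i hi.1 j hj.1 hij).2.1.2.2 k hi.2 l hj.2
  let Q : Finset (ι × ℕ) := {z ∈ I ×ˢ range r | X z ∉ E ∧ Y z ∉ E}
  have hQ : Q ⊆ I ×ˢ range r := filter_subset _ _
  have hcard : N ≤ #Q := by
    have count : ∀ u : ι × ℕ → V, Set.InjOn u (I ×ˢ range r : Finset (ι × ℕ)) →
        #{z ∈ I ×ˢ range r | u z ∈ E} ≤ #E := fun u hu =>
      card_le_card_of_injOn u (fun z hz => (mem_filter.1 hz).2)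
        (hu.mono fun z hz => (mem_filter.1 hz).1)
    have h1 : I ×ˢ range r ⊆
        Q ∪ ({z ∈ I ×ˢ range r | X z ∈ E} ∪ {z ∈ I ×ˢ range r | Y z ∈ E}) := by
      intro z hz
      simp only [Q, mem_union, mem_filter, hz, true_and]
      tauto
    have h2 := (card_le_card h1).trans ((card_union_le _ _).trans
      (Nat.add_le_add_left (card_union_le _ _) _))
    have h3 := count X hX
    have h4 := count Y hY
    rw [card_product, card_range] at h2
    omega
  have hR := pr_ne_le_of_card_image_le a^[K] hK
  have h0 : 0 ≤ 1 - 1 / (K : ℝ) := (pr_nonneg _).trans hR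
  have h1 : 1 - 1 / (K : ℝ) ≤ 1 := by
    have : 0 ≤ 1 / (K : ℝ) := by positivity
    linarith
  refine le_trans (pr_mono fun b hb z hz => ?_) ((pr_forall_pair_le (W := V) Q X Y
    (fun z hz w hw => hXY z (hQ hz) w (hQ hw)) (hX.mono hQ) (hY.mono hQ)
    (fun z : V × V => a^[K] z.1 ≠ a^[K] z.2) hR).trans (pow_le_pow_of_le_one h0 h1 hcard))
  obtain ⟨hz1, hz2, hz3⟩ := mem_filter.1 hz
  have h2 := hb z.1 (mem_product.1 hz1).1 z.2 (mem_range.1 (mem_product.1 hz1).2)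
  rwa [piecewise_eq_of_notMem _ _ _ hz2, piecewise_eq_of_notMem _ _ _ hz3] at h2

/-- The points `p` and `q` are not merged by any of the maps
`a^[K] ∘ b ∘ a^[k] ∘ b ∘ a^[i] ∘ b`, although the orbits of `b p` and `b q` are long. -/
def IsUnmerged {V : Type*} (a : V → V) (K l r : ℕ) (p q : V) (b : V → V) : Prop :=
  InjOrbit a l (b p) ∧ InjOrbit a l (b q) ∧ ∀ i < l, ∀ k < r,
    a^[K] (b (a^[k] (b (a^[i] (b p))))) ≠ a^[K] (b (a^[k] (b (a^[i] (b q)))))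

lemma pr_isUnmerged_le (a : V → V) {K : ℕ} (hK : #(univ.image a^[K]) ≤ K) {m : ℕ}
    (hm : 0 < m) (r : ℕ) (hJ : pr (fun z : V × V => ¬ DisjointOrbits a (r + 12) (r + 12) z.1 z.2) ≤
      1 / (8192 * m)) (p q : V) :
    pr (IsUnmerged a K (6 * m + 4) (r + 12) p q) ≤ (1 / 2) ^ m + (1 - 1 / K) ^ (m * r) := by
  have : Nonempty V := ⟨p⟩
  have hm0 : (0 : ℝ) < m := by exact_mod_cast hm
  have hm1 : (1 : ℝ) ≤ m := by exact_mod_cast hm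
  have h0 : 0 ≤ 1 - 1 / (K : ℝ) := (pr_nonneg _).trans (pr_ne_le_of_card_image_le a^[K] hK)
  set θ : ℝ := 1 / (128 * m) with hθ
  have hθ0 : 0 < θ := by positivity
  have hκ : ∀ Z : Finset V, #Z ≤ 2 * m →
      pr (IsRejected (DisjointOrbits a (r + 12) (r + 12)) θ Z) ≤ 1 / 8 := by
    intro Z hZ
    refine (pr_isRejected_le _ hθ0 hJ Z).trans ?_
    have e1 : 1 / (8192 * (m : ℝ)) / θ = 1 / 64 := by
      rw [hθ]
      field_simp
      norm_num
    have e2 : (#Z : ℝ) * (2 * θ) ≤ 1 / 32 := by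
      have : (#Z : ℝ) ≤ 2 * m := by exact_mod_cast hZ
      calc (#Z : ℝ) * (2 * θ) ≤ 2 * m * (2 * θ) := by gcongr
        _ = 1 / 32 := by
          rw [hθ]
          field_simp
          norm_num
    have e3 : 1 / (8192 * (m : ℝ)) ≤ 1 / 32 := by
      gcongr
      linarith
    rw [e1]
    linarith
  have hc : 0 ≤ (1 / 2 : ℝ) ^ m + (1 - 1 / K) ^ (m * r) := by positivity
  have step := pr_le_of_resample ({p, q} : Finset V) (X := fun _ => False) hc
    (P := IsUnmerged a K (6 * m + 4) (r + 12) p q) fun b => Or.inr ?_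
  · simpa [pr] using step
  have ep : ∀ b' : V → V, ({p, q} : Finset V).piecewise b b' p = b p := fun b' => by simp
  have eq : ∀ b' : V → V, ({p, q} : Finset V).piecewise b b' q = b q := fun b' => by simp
  simp only [IsUnmerged, ep, eq]
  by_cases hx : InjOrbit a (6 * m + 4) (b p)
  swap
  · simpa [hx, pr] using hc
  by_cases hy : InjOrbit a (6 * m + 4) (b q)
  swap
  · simpa [hy, pr] using hc
  by_cases hxy : ∀ i < 6 * m + 4, a^[i] (b p) ≠ a^[i] (b q)
  swap
  · push Not at hxy
    obtain ⟨i, hi, he⟩ := hxy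
    refine le_trans (pr_mono (Q := fun _ => False) fun b' hb' => ?_) (by simpa [pr] using hc)
    exact hb'.2.2 i hi 0 (by omega) (by rw [ep, eq, he])
  obtain ⟨I, hI, hIcard, hE, hd⟩ := exists_disjoint_pairs hx hy hxy {p, q} (2 * m) (by
    have := card_le_two (a := p) (b := q)
    omega)
  set s : ℕ → V := fun i => a^[i] (b p) with hs
  set t : ℕ → V := fun i => a^[i] (b q) with ht
  have hIl : (I : Set ℕ) ⊆ Set.Iio (6 * m + 4) := fun i hi => by simpa using hI hi
  have hacc := pr_forall_not_isAccepted_le (fun u v h => DisjointOrbits.symm h) (by norm_num) hκ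
    hIcard hd (hx.mono hIl) (hy.mono hIl)
  norm_num at hacc
  simp only [hx, hy, true_and]
  refine (pr_le_of_resample (I.image s ∪ I.image t) (pow_nonneg h0 (m * r)) fun b' =>
    or_iff_not_imp_left.2 fun hb' => ?_).trans (add_le_add_left (hacc.trans_eq (by simp)) _)
  push Not at hb'
  obtain ⟨I', hI', hI'm, hacc'⟩ := hb'
  set E : Finset V := {p, q} ∪ (I.image s ∪ I.image t) with hEdef
  refine le_trans (pr_mono fun b'' hb'' => ?_) (pr_forall_ne_of_isAccepted_le a hK hacc' E
    (N := m * r) ?_ (({p, q} : Finset V).piecewise b b'))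
  · intro i hi k hk
    have e1 : ({p, q} : Finset V).piecewise b ((I.image s ∪ I.image t).piecewise b' b'') =
        E.piecewise (({p, q} : Finset V).piecewise b b') b'' := by
      ext v
      by_cases h1 : v ∈ ({p, q} : Finset V)
      · rw [piecewise_eq_of_mem _ _ _ h1, piecewise_eq_of_mem _ _ _ (mem_union_left _ h1),
          piecewise_eq_of_mem _ _ _ h1]
      · rw [piecewise_eq_of_notMem _ _ _ h1]
        by_cases h2 : v ∈ I.image s ∪ I.image t
        · rw [piecewise_eq_of_mem _ _ _ h2, piecewise_eq_of_mem _ _ _ (mem_union_right _ h2),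
            piecewise_eq_of_notMem _ _ _ h1]
        · rw [piecewise_eq_of_notMem _ _ _ h2, piecewise_eq_of_notMem _ _ _ (by
            rw [hEdef, mem_union]; tauto)]
    have h1 := hb'' i (hIl (hI' hi)) k hk
    rw [ep, eq, e1] at h1
    have e2 : E.piecewise (({p, q} : Finset V).piecewise b b') b'' (s i) = b' (s i) := by
      rw [piecewise_eq_of_mem _ _ _ (mem_union_right _ (mem_union_left _
        (mem_image_of_mem s (hI' hi)))), piecewise_eq_of_notMem _ _ _ (hE i (hI' hi)).1]
    have e3 : E.piecewise (({p, q} : Finset V).piecewise b b') b'' (t i) = b' (t i) := by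
      rw [piecewise_eq_of_mem _ _ _ (mem_union_right _ (mem_union_right _
        (mem_image_of_mem t (hI' hi)))), piecewise_eq_of_notMem _ _ _ (hE i (hI' hi)).2]
    simp only [s, t] at e2 e3
    rwa [e2, e3] at h1
  · have h1 : #E ≤ 2 + 4 * m := by
      refine (card_union_le _ _).trans (add_le_add card_le_two ((card_union_le _ _).trans ?_))
      have h2 := card_image_le (s := I) (f := s)
      have h3 := card_image_le (s := I) (f := t)
      omega
    have h2 : m * (r + 12) ≤ #I' * (r + 12) := Nat.mul_le_mul_right _ hI'm
    rw [mul_add] at h2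
    omega

end Merging
section TwoMaps

open Finset

variable {V : Type*} [Fintype V] [DecidableEq V]

/-- The map `a^[K]` has at most `K` values, any two of which are merged by a map
`a^[K] ∘ b ∘ a^[k] ∘ b ∘ a^[i] ∘ b` with `i < l` and `k < r`. -/
def IsMerging (K l r : ℕ) (a b : V → V) : Prop :=
  #(univ.image a^[K]) ≤ K ∧ ∀ p ∈ univ.image a^[K], ∀ q ∈ univ.image a^[K], ∃ i < l, ∃ k < r,
    a^[K] (b (a^[k] (b (a^[i] (b p))))) = a^[K] (b (a^[k] (b (a^[i] (b q)))))

lemma pr_lt_pr_not_disjointOrbits_le [Nonempty V] (r : ℕ) {t : ℝ} (ht : 0 < t) :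
    pr (fun a : V → V => t < pr fun z : V × V => ¬ DisjointOrbits a r r z.1 z.2) ≤
      4 * r ^ 2 / Fintype.card V / t := by
  refine (pr_lt_le _ (fun a => pr_nonneg _) ht).trans ?_
  refine div_le_div_of_nonneg_right ?_ ht.le
  rw [← pr_prod (fun x : (V → V) × (V × V) => ¬ DisjointOrbits x.1 r r x.2.1 x.2.2)]
  exact pr_not_disjointOrbits_le r

lemma pr_exists_not_injOrbit_le [Nonempty V] (K l : ℕ) :
    pr (fun x : (V → V) × (V → V) => #(univ.image x.1^[K]) ≤ K ∧
      ∃ p ∈ univ.image x.1^[K], ¬ InjOrbit x.1 l (x.2 p)) ≤ K * (l ^ 2 / Fintype.card V) := by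
  have h1 : ∀ a : V → V, pr (fun b : V → V => #(univ.image a^[K]) ≤ K ∧
      ∃ p ∈ univ.image a^[K], ¬ InjOrbit a l (b p)) ≤ K * pr (fun z => ¬ InjOrbit a l z) := by
    intro a
    by_cases ha : #(univ.image a^[K]) ≤ K
    · simp only [ha, true_and]
      refine (pr_exists_le _ _).trans ((sum_le_sum fun p _ =>
        (pr_apply_mem p fun z => ¬ InjOrbit a l z).le).trans ?_)
      rw [sum_const, nsmul_eq_mul]
      gcongr
      exact pr_nonneg _
    · have h0 : pr (fun _ : V → V => False) = 0 := by simp [pr]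
      simp only [ha, false_and, h0]
      exact mul_nonneg (Nat.cast_nonneg K) (pr_nonneg _)
  have h2 : pr (fun x : (V → V) × V => ¬ InjOrbit x.1 l x.2) ≤ l ^ 2 / Fintype.card V :=
    pr_le_of_forall_right (by positivity) fun z => pr_not_injOrbit_le l z
  rw [pr_prod]
  rw [pr_prod] at h2
  refine le_trans ?_ (mul_le_mul_of_nonneg_left h2 (Nat.cast_nonneg K))
  rw [← mul_div_assoc, mul_sum]
  gcongr with a
  exact h1 a

lemma pr_not_isMerging_le [Nonempty V] (K : ℕ) {m : ℕ} (hm : 0 < m) (r : ℕ) :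
    pr (fun x : (V → V) × (V → V) => ¬ IsMerging K (6 * m + 4) (r + 12) x.1 x.2) ≤
      Fintype.card V * (Fintype.card V + 2) * Real.exp (-(K * (K + 1) / (2 * Fintype.card V))) +
      4 * (r + 12) ^ 2 / Fintype.card V * (8192 * m) +
      K * ((6 * m + 4) ^ 2 / Fintype.card V) +
      K ^ 2 * ((1 / 2) ^ m + (1 - 1 / K) ^ (m * r)) := by
  have hm0 : (0 : ℝ) < m := by exact_mod_cast hm
  let Q : (V → V) → Prop := fun a => K < #(univ.image a^[K]) ∨
    1 / (8192 * (m : ℝ)) < pr fun z : V × V => ¬ DisjointOrbits a (r + 12) (r + 12) z.1 z.2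
  have hQ : pr Q ≤ Fintype.card V * (Fintype.card V + 2) *
      Real.exp (-(K * (K + 1) / (2 * Fintype.card V))) +
      4 * (r + 12) ^ 2 / Fintype.card V * (8192 * m) := by
    refine (pr_or_le _ _).trans (add_le_add (pr_lt_card_image_iterate_le K) ?_)
    refine (pr_lt_pr_not_disjointOrbits_le (r + 12) (by positivity)).trans (le_of_eq ?_)
    push_cast
    rw [one_div, div_inv_eq_mul]
  have hc : 0 ≤ (K : ℝ) ^ 2 * ((1 / 2) ^ m + (1 - 1 / K) ^ (m * r)) := by
    have : 0 ≤ 1 - 1 / (K : ℝ) := by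
      rcases Nat.eq_zero_or_pos K with h | h
      · simp [h]
      · have : (1 : ℝ) ≤ K := by exact_mod_cast h
        rw [sub_nonneg, div_le_one (by positivity)]
        exact this
    positivity
  have h1 : pr (fun x : (V → V) × (V → V) => Q x.1 ∨ ∃ z ∈ univ.image x.1^[K] ×ˢ univ.image x.1^[K],
      IsUnmerged x.1 K (6 * m + 4) (r + 12) z.1 z.2 x.2) ≤
      pr Q + K ^ 2 * ((1 / 2) ^ m + (1 - 1 / K) ^ (m * r)) := by
    refine pr_prod_le hc fun a => or_iff_not_imp_left.2 fun ha => ?_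
    have ha' := ha
    simp only [Q, not_or, not_lt] at ha'
    simp only [ha, false_or]
    refine (pr_exists_le _ _).trans ((sum_le_sum fun z _ =>
      pr_isUnmerged_le a ha'.1 hm r ha'.2 z.1 z.2).trans ?_)
    rw [sum_const, nsmul_eq_mul]
    have h2 : 0 ≤ (1 / 2 : ℝ) ^ m + (1 - 1 / K) ^ (m * r) :=
      (pr_nonneg _).trans (pr_isUnmerged_le a ha'.1 hm r ha'.2 (Classical.arbitrary V)
        (Classical.arbitrary V))
    gcongr
    rw [card_product, sq]
    exact_mod_cast Nat.mul_le_mul ha'.1 ha'.1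
  have h2 := pr_exists_not_injOrbit_le (V := V) K (6 * m + 4)
  push_cast at h2
  refine le_trans (pr_mono fun x hx => ?_) ((pr_or_le _ _).trans ((add_le_add h1 h2).trans ?_))
  · by_contra hcon
    rw [not_or, not_or, not_or] at hcon
    obtain ⟨⟨⟨hK, -⟩, hmerge⟩, horbit⟩ := hcon
    have hK' := not_lt.1 hK
    have horbit' : ∀ p ∈ univ.image x.1^[K], InjOrbit x.1 (6 * m + 4) (x.2 p) := fun p hp => by
      by_contra h
      exact horbit ⟨hK', p, hp, h⟩
    refine hx ⟨hK', fun p hp q hq => ?_⟩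
    by_contra! hpq
    exact hmerge ⟨(p, q), mem_product.2 ⟨hp, hq⟩, horbit' p hp, horbit' q hq, hpq⟩
  · linarith

end TwoMaps

section Words

open Finset

variable {n : ℕ} {A : Type*} (δ : Fin n → A → Fin n)

lemma act_append (u v : List A) (q : Fin n) : act δ (u ++ v) q = act δ v (act δ u q) := by
  induction u generalizing q with
  | nil => rfl
  | cons c u ih => exact ih _

lemma act_replicate (k : ℕ) (c : A) (q : Fin n) :
    act δ (List.replicate k c) q = (fun p => δ p c)^[k] q := by
  induction k generalizing q with
  | zero => rfl
  | succ k ih => exact ih _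

/-- If any two points of `T` can be merged by a word of length at most `L` whose action takes values
in `T`, then so can all the points of a set `S ⊆ T`, by a word of length at most `(#S - 1) * L`. -/
lemma exists_word_merging {T : Finset (Fin n)} {L : ℕ} (hT : ∀ p ∈ T, ∀ q ∈ T, ∃ v : List A,
    v.length ≤ L ∧ act δ v p = act δ v q ∧ ∀ x, act δ v x ∈ T) (k : ℕ) {S : Finset (Fin n)}
    (hS : S ⊆ T) (hk : #S ≤ k + 1) :
    ∃ w : List A, w.length ≤ k * L ∧ ∀ p ∈ S, ∀ q ∈ S, act δ w p = act δ w q := by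
  induction k generalizing S with
  | zero => exact ⟨[], by simp, fun p hp q hq => by rw [card_le_one.1 hk p hp q hq]⟩
  | succ k ih =>
    by_cases hS1 : #S ≤ k + 1
    · obtain ⟨w, hw, hw'⟩ := ih hS hS1
      exact ⟨w, hw.trans (Nat.mul_le_mul_right _ (Nat.le_succ k)), hw'⟩
    obtain ⟨p, hp, q, hq, hpq⟩ := one_lt_card.1 (show 1 < #S by omega)
    obtain ⟨v, hv, hvpq, hvT⟩ := hT p (hS hp) q (hS hq)
    have hlt : #(S.image (act δ v)) < #S :=
      lt_of_le_of_ne card_image_le fun h => hpq (card_image_iff.1 h hp hq hvpq)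
    obtain ⟨w, hw, hw'⟩ := ih (S := S.image (act δ v))
      (image_subset_iff.2 fun x _ => hvT x) (by omega)
    refine ⟨v ++ w, ?_, fun x hx y hy => ?_⟩
    · rw [List.length_append, Nat.succ_mul]
      omega
    · rw [act_append, act_append]
      exact hw' _ (mem_image_of_mem _ hx) _ (mem_image_of_mem _ hy)

lemma exists_isSyncWord_of_isMerging [NeZero n] {K l r : ℕ} {c d : A}
    (h : IsMerging K l r (fun q => δ q c) (fun q => δ q d)) :
    ∃ w : List A, w.length ≤ K + K * (3 + l + r + K) ∧ IsSyncWord δ w := by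
  obtain ⟨hK, hmerge⟩ := h
  set T := univ.image (fun q => δ q c)^[K] with hTdef
  have hT : ∀ p ∈ T, ∀ q ∈ T, ∃ v : List A,
      v.length ≤ 3 + l + r + K ∧ act δ v p = act δ v q ∧ ∀ x, act δ v x ∈ T := by
    intro p hp q hq
    obtain ⟨i, hi, k, hk, he⟩ := hmerge p hp q hq
    refine ⟨[d] ++ List.replicate i c ++ [d] ++ List.replicate k c ++ [d] ++ List.replicate K c,
      ?_, ?_, fun x => ?_⟩
    · simp only [List.length_append, List.length_replicate, List.length_singleton]
      omega
    · simp only [act_append, act_replicate]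
      exact he
    · rw [act_append, act_replicate]
      exact mem_image_of_mem _ (mem_univ _)
  obtain ⟨w, hw, hw'⟩ := exists_word_merging δ hT K (subset_refl T) (by omega)
  refine ⟨List.replicate K c ++ w, by simpa using hw, act δ (List.replicate K c ++ w) 0,
    fun q => ?_⟩
  rw [act_append, act_append, act_replicate, act_replicate]
  exact hw' _ (mem_image_of_mem _ (mem_univ _)) _ (mem_image_of_mem _ (mem_univ _))

lemma pr_two_letters [Fintype A] [DecidableEq A] {c d : A} (hcd : c ≠ d)
    (P : (Fin n → Fin n) → (Fin n → Fin n) → Prop) :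
    pr (fun δ : Fin n → A → Fin n => P (fun q => δ q c) (fun q => δ q d)) =
      pr (fun x : (Fin n → Fin n) × (Fin n → Fin n) => P x.1 x.2) := by
  rw [← pr_apply_pair hcd (fun x : (Fin n → Fin n) × (Fin n → Fin n) => P x.1 x.2)]
  exact pr_equiv (Equiv.piComm fun (_ : Fin n) (_ : A) => Fin n)
    fun b : A → Fin n → Fin n => P (b c) (b d)

end Words
section Asymptotics

open Filter Real

lemma eventually_exp_neg_rpow_le {e : ℝ} (he : 0 < e) :
    ∀ᶠ n : ℕ in atTop, exp (-((n : ℝ) ^ e / 4)) ≤ (n : ℝ) ^ (-3 : ℝ) := by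
  have h1 := (tendsto_rpow_mul_exp_neg_mul_atTop_nhds_zero (3 / e) (1 / 4) (by norm_num)).comp
    ((tendsto_rpow_atTop he).comp tendsto_natCast_atTop_atTop)
  filter_upwards [h1.eventually_le_const one_pos, eventually_ge_atTop 1] with n hn hn1
  have hx : (0 : ℝ) < n := by exact_mod_cast hn1
  simp only [Function.comp_apply] at hn
  rw [← rpow_mul hx.le, mul_div_cancel₀ _ he.ne'] at hn
  rw [rpow_neg hx.le, ← one_div, le_div_iff₀ (by positivity), mul_comm]
  convert hn using 3
  ring

lemma sq_rpow_half_add {x e X : ℝ} (hx0 : 0 < x) (hX : X = x ^ (1 / 2 + e)) :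
    X ^ 2 = x ^ (1 + 2 * e) := by
  rw [hX, ← rpow_mul_natCast hx0.le]
  congr 1
  push_cast
  ring

lemma exp_term_le {x e X : ℝ} (hx1 : 1 ≤ x) (he0 : 0 < e) (hX : X = x ^ (1 / 2 + e)) {K : ℕ}
    (hK0 : (1 : ℝ) ≤ K) (hK2 : X < K + 1) (hexp : exp (-(x ^ e / 4)) ≤ x ^ (-3 : ℝ)) :
    x * (x + 2) * exp (-(K * (K + 1) / (2 * x))) ≤ 3 * x ^ (-(1 / 8) : ℝ) := by
  have hx0 : 0 < x := by linarith
  have mono : ∀ {s t : ℝ}, s ≤ t → x ^ s ≤ x ^ t := fun h => rpow_le_rpow_of_exponent_le hx1 h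
  have hXX := sq_rpow_half_add hx0 hX
  have hX0 : 0 ≤ X := hX ▸ rpow_nonneg hx0.le _
  have h1 : x ^ e / 4 ≤ K * (K + 1) / (2 * x) := by
    rw [div_le_div_iff₀ (by norm_num) (by positivity)]
    have h2 : x ^ e * x ≤ X ^ 2 := by
      rw [hXX]
      nth_rw 2 [← rpow_one x]
      rw [← rpow_add hx0]
      exact mono (by linarith)
    have h3 : X ≤ 2 * K := by linarith
    have h4 : X * X ≤ 2 * K * (K + 1) := by gcongr
    nlinarith
  have h5 : exp (-(K * (K + 1) / (2 * x))) ≤ x ^ (-3 : ℝ) :=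
    (exp_le_exp.2 (neg_le_neg h1)).trans hexp
  calc x * (x + 2) * exp (-(K * (K + 1) / (2 * x))) ≤ (3 * x ^ (2 : ℝ)) * x ^ (-3 : ℝ) := by
        refine mul_le_mul ?_ h5 (exp_nonneg _) (by positivity)
        rw [rpow_two]
        nlinarith
    _ = 3 * x ^ (-1 : ℝ) := by
        rw [mul_assoc, ← rpow_add hx0]
        norm_num
    _ ≤ _ := by gcongr 3 * ?_; exact mono (by norm_num)

lemma orbit_term_le {x e M R : ℝ} (hx1 : 1 ≤ x) (he1 : e < 1 / 160) (hM : M = x ^ (1 / 6 : ℝ))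
    (hR : R = x ^ (1 / 3 + 2 * e)) (hM1 : 1 ≤ M) (hR1 : 1 ≤ R) {m r : ℕ} (hm2 : (m : ℝ) < M + 1)
    (hr2 : (r : ℝ) < R + 1) :
    4 * (r + 12) ^ 2 / x * (8192 * m) ≤ 12845056 * x ^ (-(1 / 8) : ℝ) := by
  have hx0 : 0 < x := by linarith
  have mono : ∀ {s t : ℝ}, s ≤ t → x ^ s ≤ x ^ t := fun h => rpow_le_rpow_of_exponent_le hx1 h
  have hRR : R ^ 2 = x ^ (2 / 3 + 4 * e) := by
    rw [hR, ← rpow_mul_natCast hx0.le]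
    congr 1
    push_cast
    ring
  calc 4 * ((r : ℝ) + 12) ^ 2 / x * (8192 * m)
      ≤ 4 * (14 * R) ^ 2 / x * (8192 * (2 * M)) := by
        gcongr <;> linarith
    _ = 12845056 * (R ^ 2 * M * x ^ (-1 : ℝ)) := by
        rw [rpow_neg_one]
        ring
    _ ≤ _ := by
        rw [hRR, hM, ← rpow_add hx0, ← rpow_add hx0]
        gcongr 12845056 * ?_
        exact mono (by linarith)

lemma injOrbit_term_le {x e X M : ℝ} (hx1 : 1 ≤ x) (he1 : e < 1 / 160)
    (hX : X = x ^ (1 / 2 + e)) (hM : M = x ^ (1 / 6 : ℝ)) (hM1 : 1 ≤ M) {K m : ℕ}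
    (hK1 : (K : ℝ) ≤ X) (hm2 : (m : ℝ) < M + 1) :
    K * ((6 * m + 4) ^ 2 / x) ≤ 256 * x ^ (-(1 / 8) : ℝ) := by
  have hx0 : 0 < x := by linarith
  have mono : ∀ {s t : ℝ}, s ≤ t → x ^ s ≤ x ^ t := fun h => rpow_le_rpow_of_exponent_le hx1 h
  have hMM : M ^ 2 = x ^ (1 / 3 : ℝ) := by
    rw [hM, ← rpow_mul_natCast hx0.le]
    congr 1
    norm_num
  have hX0 : 0 ≤ X := hX ▸ rpow_nonneg hx0.le _
  calc (K : ℝ) * ((6 * m + 4) ^ 2 / x) ≤ X * ((16 * M) ^ 2 / x) := by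
        gcongr
        linarith
    _ = 256 * (X * M ^ 2 * x ^ (-1 : ℝ)) := by
        rw [rpow_neg_one]
        ring
    _ ≤ _ := by
        rw [hMM, hX, ← rpow_add hx0, ← rpow_add hx0]
        gcongr 256 * ?_
        exact mono (by linarith)

lemma merging_term_le {x e X M R : ℝ} (hx1 : 1 ≤ x) (he1 : e < 1 / 160)
    (hX : X = x ^ (1 / 2 + e)) (hM : M = x ^ (1 / 6 : ℝ)) (hR : R = x ^ (1 / 3 + 2 * e))
    (hexp : exp (-(x ^ e / 4)) ≤ x ^ (-3 : ℝ)) {K m r : ℕ} (hK0 : (1 : ℝ) ≤ K)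
    (hK1 : (K : ℝ) ≤ X) (hm1 : M ≤ m) (hr1 : R ≤ r) :
    K ^ 2 * ((1 / 2) ^ m + (1 - 1 / K) ^ (m * r)) ≤ 2 * x ^ (-(1 / 8) : ℝ) := by
  have hx0 : 0 < x := by linarith
  have mono : ∀ {s t : ℝ}, s ≤ t → x ^ s ≤ x ^ t := fun h => rpow_le_rpow_of_exponent_le hx1 h
  have hXX := sq_rpow_half_add hx0 hX
  have hM0 : 0 ≤ M := hM ▸ rpow_nonneg hx0.le _
  have hR0 : 0 ≤ R := hR ▸ rpow_nonneg hx0.le _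
  have h1 : (1 / 2 : ℝ) ^ m ≤ x ^ (-3 : ℝ) := by
    refine le_trans ?_ hexp
    have h2 : (1 / 2 : ℝ) ≤ exp (-(1 / 2)) := by
      have := one_sub_le_exp_neg (1 / 2 : ℝ)
      linarith
    refine (pow_le_pow_left₀ (by norm_num) h2 m).trans ?_
    rw [← exp_nat_mul]
    have h3 : x ^ e ≤ M := hM ▸ mono (by linarith)
    exact exp_le_exp.2 (by linarith)
  have h5 : (0 : ℝ) ≤ 1 - 1 / K := by
    rw [sub_nonneg, div_le_one (by linarith)]
    exact hK0
  have h4 : (1 - 1 / K : ℝ) ^ (m * r) ≤ x ^ (-3 : ℝ) := by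
    refine le_trans ?_ hexp
    refine (pow_le_pow_left₀ h5 (one_sub_le_exp_neg _) _).trans ?_
    rw [← exp_nat_mul]
    refine exp_le_exp.2 ?_
    have h6 : x ^ e * X = M * R := by
      rw [hX, hM, hR, ← rpow_add hx0, ← rpow_add hx0]
      congr 1
      ring
    have h7 : x ^ e ≤ m * r / K := by
      rw [le_div_iff₀ (by linarith)]
      calc x ^ e * K ≤ x ^ e * X := by gcongr
        _ = M * R := h6
        _ ≤ m * r := by gcongr
    have h8 : 0 ≤ x ^ e := by positivity
    push_cast
    rw [mul_neg, mul_one_div]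
    linarith
  calc (K : ℝ) ^ 2 * ((1 / 2) ^ m + (1 - 1 / K) ^ (m * r))
      ≤ X ^ 2 * (x ^ (-3 : ℝ) + x ^ (-3 : ℝ)) :=
        mul_le_mul (by gcongr) (add_le_add h1 h4) (by positivity) (by positivity)
    _ = 2 * (X ^ 2 * x ^ (-3 : ℝ)) := by ring
    _ ≤ _ := by
        rw [hXX, ← rpow_add hx0]
        gcongr 2 * ?_
        exact mono (by linarith)

lemma eventually_exists_parameters {e : ℝ} (he0 : 0 < e) (he1 : e < 1 / 160) :
    ∀ᶠ n : ℕ in atTop, ∃ K m r : ℕ, 0 < m ∧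
      ((K + K * (3 + (6 * m + 4) + (r + 12) + K) : ℕ) : ℝ) < (n : ℝ) ^ (1 + 20 * e) ∧
      (n : ℝ) * (n + 2) * exp (-(K * (K + 1) / (2 * n))) +
      4 * (r + 12) ^ 2 / n * (8192 * m) + K * ((6 * m + 4) ^ 2 / n) +
      K ^ 2 * ((1 / 2) ^ m + (1 - 1 / K) ^ (m * r)) ≤ 13000000 * (n : ℝ) ^ (-(1 / 8) : ℝ) := by
  have hbig := ((tendsto_rpow_atTop (show 0 < 18 * e by linarith)).comp
    tendsto_natCast_atTop_atTop).eventually_gt_atTop (35 : ℝ)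
  filter_upwards [eventually_exp_neg_rpow_le he0, hbig, eventually_ge_atTop 1] with n hexp hbig hn
  have hx1 : (1 : ℝ) ≤ n := by exact_mod_cast hn
  simp only [Function.comp_apply] at hbig
  set x : ℝ := (n : ℝ) with hx
  have hx0 : 0 < x := by linarith
  have mono : ∀ {s t : ℝ}, s ≤ t → x ^ s ≤ x ^ t := fun h => rpow_le_rpow_of_exponent_le hx1 h
  have one_le : ∀ {s : ℝ}, 0 ≤ s → 1 ≤ x ^ s := fun h => one_le_rpow hx1 h
  set X : ℝ := x ^ (1 / 2 + e) with hX
  set M : ℝ := x ^ (1 / 6 : ℝ) with hM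
  set R : ℝ := x ^ (1 / 3 + 2 * e) with hR
  have hX1 : 1 ≤ X := one_le (by linarith)
  have hM1 : 1 ≤ M := one_le (by linarith)
  have hR1 : 1 ≤ R := one_le (by linarith)
  have hMX : M ≤ X := mono (by linarith)
  have hRX : R ≤ X := mono (by linarith)
  obtain ⟨K, hK1, hK2⟩ : ∃ K : ℕ, (K : ℝ) ≤ X ∧ X < K + 1 :=
    ⟨⌊X⌋₊, Nat.floor_le (by linarith), Nat.lt_floor_add_one X⟩
  obtain ⟨m, hm1, hm2⟩ : ∃ m : ℕ, M ≤ m ∧ (m : ℝ) < M + 1 :=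
    ⟨⌈M⌉₊, Nat.le_ceil M, Nat.ceil_lt_add_one (by linarith)⟩
  obtain ⟨r, hr1, hr2⟩ : ∃ r : ℕ, R ≤ r ∧ (r : ℝ) < R + 1 :=
    ⟨⌈R⌉₊, Nat.le_ceil R, Nat.ceil_lt_add_one (by linarith)⟩
  have hK0 : (1 : ℝ) ≤ K := by
    have : 0 < K := by
      by_contra h
      have : K = 0 := by omega
      rw [this] at hK2
      norm_num at hK2
      linarith
    exact_mod_cast this
  have hXX := sq_rpow_half_add hx0 hX
  refine ⟨K, m, r, ?_, ?_, ?_⟩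
  · have : (0 : ℝ) < m := by linarith
    exact_mod_cast this
  · have h1 : x ^ (1 + 20 * e) = X ^ 2 * x ^ (18 * e) := by
      rw [hXX, ← rpow_add hx0]
      congr 1
      ring
    rw [h1]
    push_cast
    have h2 : (K : ℝ) + K * (3 + (6 * m + 4) + (r + 12) + K) ≤ X + X * (34 * X) := by
      gcongr
      linarith
    nlinarith
  have t1 := exp_term_le hx1 he0 hX hK0 hK2 hexp
  have t2 := orbit_term_le hx1 he1 hM hR hM1 hR1 hm2 hr2
  have t3 := injOrbit_term_le hx1 he1 hX hM hM1 hK1 hm2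
  have t4 := merging_term_le hx1 he1 hX hM hR hexp hK0 hK1 hm1 hr1
  have h0 : 0 ≤ x ^ (-(1 / 8) : ℝ) := by positivity
  linarith

end Asymptotics

/-- For `0 < ε < 1/8` and an alphabet `A` with at least two letters, under the uniform
distribution on complete `n`-state deterministic automata over `A`, the probability that
the automaton has no synchronizing word of length smaller than `n^(1+ε)` is
`O(n^(-1/8+ε))`; in particular, with high probability there is a synchronizing word
of length smaller than `n^(1+ε)`. -/
theorem short_sync_word_whp (ε : ℝ) (hε0 : 0 < ε) (hε1 : ε < 1/8)
    (A : Type) [Fintype A] [DecidableEq A] (hA : 2 ≤ Fintype.card A) :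
    ∃ C : ℝ, 0 < C ∧ ∃ N : ℕ, ∀ n ≥ N,
      (((Finset.univ : Finset (Fin n → A → Fin n)).filter
          (fun δ => ¬ ∃ w : List A,
            (w.length : ℝ) < (n : ℝ) ^ ((1 : ℝ) + ε) ∧ IsSyncWord δ w)).card : ℝ)
        / (Fintype.card (Fin n → A → Fin n) : ℝ)
        ≤ C * (n : ℝ) ^ (-(1/8 : ℝ) + ε) := by
  have he0 : 0 < ε / 20 := by linarith
  have he1 : ε / 20 < 1 / 160 := by linarith
  obtain ⟨c, d, hcd⟩ := Fintype.one_lt_card_iff.1 (show 1 < Fintype.card A by omega)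
  obtain ⟨N, hN⟩ := Filter.eventually_atTop.1
    ((eventually_exists_parameters he0 he1).and (Filter.eventually_ge_atTop 1))
  refine ⟨13000000, by norm_num, N, fun n hn => ?_⟩
  obtain ⟨⟨K, m, r, hm, hlen, hbound⟩, hn1⟩ := hN n hn
  have : NeZero n := ⟨by omega⟩
  have hn1' : (1 : ℝ) ≤ n := by exact_mod_cast hn1
  rw [mul_div_cancel₀ ε (by norm_num)] at hlen
  have hmerge := pr_not_isMerging_le (V := Fin n) K hm r
  rw [Fintype.card_fin] at hmerge
  have hsync : pr (fun δ : Fin n → A → Fin n =>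
      ¬ ∃ w : List A, (w.length : ℝ) < (n : ℝ) ^ (1 + ε) ∧ IsSyncWord δ w) ≤
      13000000 * (n : ℝ) ^ (-(1 / 8) : ℝ) := by
    rw [← pr_two_letters hcd fun a b => ¬ IsMerging K (6 * m + 4) (r + 12) a b] at hmerge
    refine le_trans ?_ (hmerge.trans hbound)
    refine pr_mono fun δ hδ hM => hδ ?_
    obtain ⟨w, hw, hw'⟩ := exists_isSyncWord_of_isMerging δ hM
    exact ⟨w, lt_of_le_of_lt (by exact_mod_cast hw) hlen, hw'⟩
  refine (card_filter_div_card _).trans_le (hsync.trans ?_)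
  gcongr
  linarith
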